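/- The number of parking functions π ∈ PF(m,n) for which the fixed spots k₁ < ⋯ < k_{n−m} (with 0 =: k₀ < k₁, k_{n−m} < k_{n−m+1} := n+1) are exactly the spots never attempted by any car equals [Π_{i=0}^{n−m} (k_{i+1}−k_i)^{k_{i+1}−k_i−2}] · m!/[Π_{i=0}^{n−m} (k_{i+1}−k_i−1)!]. -/

import Mathlib

/-- `π ∈ PF(m,n)`: a sequence in `[n]^m` satisfying the pigeonhole criterion
`#{k : π k ≤ i} ≥ m - n + i` for all `i = n-m+1, …, n`, which is equivalent to
all `m` cars parking successfully under the sequential parking rule. -/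
def IsPF (m n : ℕ) (π : Fin m → ℕ) : Prop :=
  (∀ k, 1 ≤ π k ∧ π k ≤ n) ∧
  ∀ i, i ≤ n → n - m + 1 ≤ i →
    m + i - n ≤ ((Finset.univ : Finset (Fin m)).filter (fun k => π k ≤ i)).card

/-- The queue length `y_j(π)`: the number of cars that attempt to park at spot
`j`, given by `y_0 = 0` and `y_{j+1} = (if y_j = 0 then 0 else y_j - 1) + r_{j+1}`
where `r_j = #{s : π_s = j}`. Spot `j` is unattempted iff `y_j = 0`. -/
def queueLen (m : ℕ) (π : Fin m → ℕ) : ℕ → ℕ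
  | 0 => 0
  | j + 1 =>
      (if queueLen m π j = 0 then 0 else queueLen m π j - 1) +
        ((Finset.univ : Finset (Fin m)).filter (fun s => π s = j + 1)).card

/-- Pollak's circle argument: among the rotations of a placement of `l` cars on a circle of `l + 1`
spots, exactly one is a parking function. -/
theorem existsUnique_rotation {β : Type*} [Fintype β] (l : ℕ) (hl : Fintype.card β = l)
    (f : β → Fin (l + 1)) :
    ∃! p : Fin (l + 1), ∀ i ≤ l,
      i ≤ ((Finset.univ : Finset β).filter (fun s => (f s - p).val < i)).card := by
  classical
  set D : ℕ → ℕ := fun j => ((Finset.univ : Finset β).filter (fun s => (f s).val < j)).card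
    with hD
  have hval : ∀ s p, (p ≤ f s → (f s - p).val = (f s).val - p.val) ∧
      (f s < p → (f s - p).val = l + 1 + (f s).val - p.val) := fun s p =>
    ⟨fun h => Fin.sub_val_of_le h, fun h => Fin.coe_sub_iff_lt.2 h⟩
  have hA : ∀ (p : Fin (l + 1)) i, p.val + i ≤ l + 1 →
      ((Finset.univ : Finset β).filter (fun s => (f s - p).val < i)).card + D p = D (p + i) := by
    intro p i hi
    rw [hD, ← Finset.card_union_of_disjoint]
    · congr 1
      ext s
      have := hval s p
      simp only [Finset.mem_union, Finset.mem_filter, Finset.mem_univ, true_and]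
      have := (f s).isLt
      rcases le_or_gt p (f s) with h | h <;> grind
    · rw [Finset.disjoint_filter]
      intro s _ h1 h2
      have := (hval s p).2 h2
      omega
  have hB : ∀ (p : Fin (l + 1)) i, l + 1 ≤ p.val + i → i ≤ l →
      ((Finset.univ : Finset β).filter (fun s => (f s - p).val < i)).card + D p
        = l + D (p + i - (l + 1)) := by
    intro p i hi hi'
    have hle : D (p + i - (l + 1)) ≤ D p := by
      apply Finset.card_le_card
      intro s
      simp only [Finset.mem_filter, Finset.mem_univ, true_and]
      omega
    have hc : ((Finset.univ : Finset β).filter (fun s => (f s - p).val < i)).card +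
        ((Finset.univ : Finset β).filter (fun s => ¬ (f s - p).val < i)).card = l := by
      rw [Finset.card_filter_add_card_filter_not, Finset.card_univ, hl]
    have hd : ((Finset.univ : Finset β).filter (fun s => ¬ (f s - p).val < i)).card +
        D (p + i - (l + 1)) = D p := by
      rw [hD, ← Finset.card_union_of_disjoint]
      · congr 1
        ext s
        have := hval s p
        simp only [Finset.mem_union, Finset.mem_filter, Finset.mem_univ, true_and]
        have := (f s).isLt
        rcases le_or_gt p (f s) with h | h <;> grind
      · rw [Finset.disjoint_filter]
        intro s _ h1 h2
        have := (hval s p).2 (by rw [Fin.lt_def]; omega)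
        omega
    omega
  have key : ∀ p : Fin (l + 1), (∀ i ≤ l,
      i ≤ ((Finset.univ : Finset β).filter (fun s => (f s - p).val < i)).card) ↔
      ∀ q : Fin (l + 1), toLex ((D p : ℤ) - p, p) ≤ toLex ((D q : ℤ) - q, q) := by
    intro p
    simp only [Prod.Lex.toLex_le_toLex]
    constructor
    · intro h q
      rcases le_or_gt p q with hpq | hpq
      · rw [Fin.le_def] at hpq
        have h1 := h (q - p) (by omega)
        have h2 := hA p (q - p) (by omega)
        rw [Nat.add_sub_cancel' hpq] at h2
        rw [Fin.le_def]
        omega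
      · rw [Fin.lt_def] at hpq
        have h1 := h (l + 1 + q - p) (by omega)
        have h2 := hB p (l + 1 + q - p) (by omega) (by omega)
        rw [show p.val + (l + 1 + q - p) - (l + 1) = q by omega] at h2
        omega
    · intro h i hi
      by_cases hc : p.val + i ≤ l
      · have h1 := h ⟨p + i, by omega⟩
        have h2 := hA p i (by omega)
        simp only [Fin.le_def] at h1
        omega
      · have h1 := h ⟨p + i - (l + 1), by omega⟩
        have h2 := hB p i (by omega) hi
        simp only [Fin.le_def] at h1
        omega
  obtain ⟨p, hp⟩ := Finite.exists_min fun p : Fin (l + 1) => toLex ((D p : ℤ) - p, p)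
  refine ⟨p, (key p).2 hp, fun q hq => ?_⟩
  have := le_antisymm ((key q).1 hq p) (hp q)
  simpa using congrArg (fun x => (ofLex x).2) this

/-- The number of classical parking functions of length `l`, with values in `Fin (l + 1)`. -/
theorem card_fin_parking {β : Type*} [Fintype β] (l : ℕ) (hl : Fintype.card β = l) :
    Nat.card {g : β → Fin (l + 1) // ∀ i ≤ l,
      i ≤ ((Finset.univ : Finset β).filter (fun s => (g s).val < i)).card} =
      (l + 1) ^ (l - 1) := by
  classical
  set P : (β → Fin (l + 1)) → Prop := fun g => ∀ i ≤ l,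
      i ≤ ((Finset.univ : Finset β).filter (fun s => (g s).val < i)).card with hP
  have h1 : ∀ f : β → Fin (l + 1),
      ∑ p : Fin (l + 1), (if P (f - fun _ => p) then 1 else 0) = 1 := by
    intro f
    rw [← Finset.card_filter, Finset.card_eq_one]
    obtain ⟨p, hp, hu⟩ := existsUnique_rotation l hl f
    refine ⟨p, ?_⟩
    ext q
    simp only [Finset.mem_filter, Finset.mem_univ, true_and, Finset.mem_singleton]
    exact ⟨fun h => hu q h, fun h => h ▸ hp⟩
  have h2 : ∀ p : Fin (l + 1),
      ∑ f : β → Fin (l + 1), (if P (f - fun _ => p) then 1 else 0) = Nat.card {g // P g} := by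
    intro p
    rw [show ∑ f : β → Fin (l + 1), (if P (f - fun _ => p) then 1 else 0) =
        ∑ f : β → Fin (l + 1), (if P f then 1 else 0) from
        (Equiv.subRight (fun _ : β => p)).sum_comp (fun f => if P f then 1 else 0),
      ← Finset.card_filter, Nat.card_eq_fintype_card, Fintype.card_subtype]
  have h3 : (l + 1) * Nat.card {g // P g} = (l + 1) ^ l := by
    calc (l + 1) * Nat.card {g // P g}
        = ∑ p : Fin (l + 1), ∑ f : β → Fin (l + 1), (if P (f - fun _ => p) then 1 else 0) := by
          simp [h2]
      _ = (l + 1) ^ l := by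
          rw [Finset.sum_comm]
          simp [h1, hl]
  rcases l with _ | l
  · simpa using h3
  · rw [pow_succ'] at h3
    exact Nat.eq_of_mul_eq_mul_left (by omega) h3

/-- The number of classical parking functions of length `l` whose spots start at `a + 1`. -/
theorem card_parking {β : Type*} [Fintype β] (a l : ℕ) (hl : Fintype.card β = l) :
    Nat.card {h : β → ℕ // (∀ s, a < h s) ∧ ∀ i ≤ l,
      i ≤ ((Finset.univ : Finset β).filter (fun s => h s ≤ a + i)).card} =
      (l + 1) ^ (l - 1) := by
  rw [← card_fin_parking l hl]
  have hub : ∀ h : β → ℕ, (∀ i ≤ l,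
      i ≤ ((Finset.univ : Finset β).filter (fun s => h s ≤ a + i)).card) →
      ∀ s, h s ≤ a + l := by
    intro h hh s
    have : (Finset.univ : Finset β).filter (fun s => h s ≤ a + l) = Finset.univ :=
      Finset.eq_univ_of_card _ (le_antisymm (Finset.card_le_univ _) (hl ▸ hh l le_rfl))
    simpa using (Finset.ext_iff.1 this s)
  refine Nat.card_congr
    { toFun := fun h => ⟨fun s => ⟨h.1 s - (a + 1), ?_⟩, ?_⟩
      invFun := fun g => ⟨fun s => a + 1 + g.1 s, ?_, ?_⟩
      left_inv := ?_
      right_inv := ?_ }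
  · have := hub h.1 h.2.2 s
    omega
  · intro i hi
    convert h.2.2 i hi using 4 with s
    have := h.2.1 s
    simp only
    omega
  · intro s
    simp only
    omega
  · intro i hi
    convert g.2 i hi using 4 with s
    simp only
    omega
  · intro h
    ext s
    have := h.2.1 s
    simp only
    omega
  · intro g
    ext s
    simp

/-- `f` parks a car on every spot below `K T` other than `K 1, …, K (T - 1)`, and no car attempts
these spots: every block of spots strictly between `K t` and `K (t + 1)` carries a classical parking
function. -/
def IsBlockParking {α : Type*} [Fintype α] (K : ℕ → ℕ) (T : ℕ) (f : α → ℕ) : Prop :=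
  (∀ t ≤ T, ((Finset.univ : Finset α).filter (fun s => f s ≤ K t)).card + t = K t) ∧
  ∀ t < T, ∀ j, K t ≤ j → j < K (t + 1) →
    j ≤ ((Finset.univ : Finset α).filter (fun s => f s ≤ j)).card + t

theorem isBlockParking_succ_iff {α : Type*} [Fintype α] [DecidableEq α] {K : ℕ → ℕ}
    (hK : StrictMono K) {T : ℕ} (hα : Fintype.card α + (T + 1) = K (T + 1)) (A : Finset α)
    (hA : A.card + T = K T) (f : α → ℕ) :
    (IsBlockParking K (T + 1) f ∧
        (Finset.univ : Finset α).filter (fun s => f s ≤ K T) = A) ↔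
      IsBlockParking K T (fun s : {s // s ∈ A} => f s) ∧
        ((∀ s : {s // s ∉ A}, K T < f s) ∧ ∀ i ≤ K (T + 1) - K T - 1,
          i ≤ ((Finset.univ : Finset {s // s ∉ A}).filter (fun s : {s // s ∉ A} => f s ≤ K T + i)).card) := by
  have hsplit : ∀ j, ((Finset.univ : Finset α).filter (fun s => f s ≤ j)).card =
      ((Finset.univ : Finset {s // s ∈ A}).filter (fun s : {s // s ∈ A} => f s ≤ j)).card +
      ((Finset.univ : Finset {s // s ∉ A}).filter (fun s : {s // s ∉ A} => f s ≤ j)).card := by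
    intro j
    simp only [Finset.card_filter]
    convert (Fintype.sum_subtype_add_sum_subtype (fun s => s ∈ A)
      (fun s => if f s ≤ j then 1 else 0)).symm
  have hcA : Fintype.card {s // s ∈ A} = A.card := Fintype.card_coe A
  have hcB : Fintype.card {s // s ∉ A} + A.card = Fintype.card α := by
    have := Fintype.card_subtype_compl (fun s => s ∈ A)
    have := A.card_le_univ
    omega
  have hlt : K T < K (T + 1) := hK (Nat.lt_succ_self T)
  have hlow : (∀ s : {s // s ∉ A}, K T < f s) → ∀ j ≤ K T,
      ((Finset.univ : Finset {s // s ∉ A}).filter (fun s : {s // s ∉ A} => f s ≤ j)).card = 0 := by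
    intro h j hj
    rw [Finset.card_eq_zero, Finset.filter_eq_empty_iff]
    intro s _
    have := h s
    omega
  have hhigh : (∀ s : {s // s ∈ A}, f s ≤ K T) → ∀ j, K T ≤ j →
      ((Finset.univ : Finset {s // s ∈ A}).filter (fun s : {s // s ∈ A} => f s ≤ j)).card = A.card := by
    intro h j hj
    rw [Finset.filter_true_of_mem fun s _ => (h s).trans hj, Finset.card_univ, hcA]
  simp only [IsBlockParking]
  constructor
  · rintro ⟨⟨h1, h2⟩, rfl⟩
    have ha : ∀ s : {s // s ∈ (Finset.univ : Finset α).filter (fun s => f s ≤ K T)},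
        f s ≤ K T := fun s => (Finset.mem_filter.1 s.2).2
    have hb : ∀ s : {s // s ∉ (Finset.univ : Finset α).filter (fun s => f s ≤ K T)},
        K T < f s := fun s => by simpa using s.2
    refine ⟨⟨fun t ht => ?_, fun t ht j hj hj' => ?_⟩, hb, fun i hi => ?_⟩
    · have := h1 t (by omega)
      have := hsplit (K t)
      have := hlow hb (K t) (hK.monotone ht)
      omega
    · have := h2 t (by omega) j hj hj'
      have := hsplit j
      have := hlow hb j (hj'.le.trans (hK.monotone ht))
      omega
    · have := h2 T (by omega) (K T + i) (by omega) (by omega)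
      have := hsplit (K T + i)
      have := hhigh ha (K T + i) (by omega)
      omega
  · rintro ⟨⟨h1, h2⟩, hb, h3⟩
    have ha : ∀ s : {s // s ∈ A}, f s ≤ K T := by
      intro s
      have := Finset.eq_univ_of_card
        ((Finset.univ : Finset {s // s ∈ A}).filter (fun s : {s // s ∈ A} => f s ≤ K T))
        (by have := h1 T le_rfl; omega)
      simpa using Finset.ext_iff.1 this s
    refine ⟨⟨fun t ht => ?_, fun t ht j hj hj' => ?_⟩, ?_⟩
    · rw [hsplit]
      rcases Nat.lt_or_eq_of_le ht with ht | rfl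
      · have := h1 t (by omega)
        have := hlow hb (K t) (hK.monotone (by omega))
        omega
      · have := hhigh ha (K (T + 1)) hlt.le
        have := h3 (K (T + 1) - K T - 1) le_rfl
        have hle : ((Finset.univ : Finset {s // s ∉ A}).filter
            (fun s : {s // s ∉ A} => f s ≤ K T + (K (T + 1) - K T - 1))).card ≤
            ((Finset.univ : Finset {s // s ∉ A}).filter (fun s : {s // s ∉ A} => f s ≤ K (T + 1))).card := by
          apply Finset.card_le_card
          intro s
          simp only [Finset.mem_filter, Finset.mem_univ, true_and]
          omega
        have := Finset.card_le_univ
          ((Finset.univ : Finset {s // s ∉ A}).filter (fun s : {s // s ∉ A} => f s ≤ K (T + 1)))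
        omega
    · rw [hsplit]
      rcases Nat.lt_or_eq_of_le (Nat.lt_succ_iff.1 ht) with ht | rfl
      · have := h2 t ht j hj hj'
        omega
      · have := hhigh ha j hj
        have := h3 (j - K t) (by omega)
        rw [Nat.add_sub_cancel' hj] at this
        omega
    · ext s
      simp only [Finset.mem_filter, Finset.mem_univ, true_and]
      exact ⟨fun h => by_contra fun hs => (hb ⟨s, hs⟩).not_ge h, fun hs => ha ⟨s, hs⟩⟩

theorem card_isBlockParking {K : ℕ → ℕ} (hK : StrictMono K) (T : ℕ) :
    ∀ {α : Type*} [Fintype α], Fintype.card α + T = K T → K 0 = 0 →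
    Nat.card {f : α → ℕ // IsBlockParking K T f} *
        ∏ t ∈ Finset.range T, (K (t + 1) - K t - 1).factorial =
      (∏ t ∈ Finset.range T, (K (t + 1) - K t) ^ (K (t + 1) - K t - 2)) *
        (Fintype.card α).factorial := by
  induction T with
  | zero =>
    intro α _ hα h0
    have : IsEmpty α := Fintype.card_eq_zero_iff.1 (by omega)
    have : Unique {f : α → ℕ // IsBlockParking K 0 f} :=
      { default := ⟨isEmptyElim, by simp [IsBlockParking, h0]⟩
        uniq := fun f => Subtype.ext (Subsingleton.elim _ _) }
    simp
  | succ T ih =>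
    intro α _ hα h0
    classical
    have hT : T ≤ K T := hK.id_le T
    have hlt : K T < K (T + 1) := hK (Nat.lt_succ_self T)
    set M := K T - T with hM
    set l := K (T + 1) - K T - 1 with hl
    have hαl : Fintype.card α = l + M := by omega
    let F : {f : α → ℕ // IsBlockParking K (T + 1) f} → {A : Finset α // A.card = M} :=
      fun f => ⟨(Finset.univ : Finset α).filter (fun s => f.1 s ≤ K T), by
        have := f.2.1 T (by omega)
        omega⟩
    have hfiber : ∀ A : {A : Finset α // A.card = M},
        Nat.card {f // F f = A} * ∏ t ∈ Finset.range T, (K (t + 1) - K t - 1).factorial =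
          ((∏ t ∈ Finset.range T, (K (t + 1) - K t) ^ (K (t + 1) - K t - 2)) * M.factorial) *
            (l + 1) ^ (l - 1) := by
      rintro ⟨A, hA⟩
      have e : {f // F f = ⟨A, hA⟩} ≃
          {g : {s // s ∈ A} → ℕ // IsBlockParking K T g} ×
          {h : {s // s ∉ A} → ℕ // (∀ s, K T < h s) ∧ ∀ i ≤ l,
            i ≤ ((Finset.univ : Finset {s // s ∉ A}).filter (fun s => h s ≤ K T + i)).card} :=
        ((Equiv.subtypeEquivRight fun f => by simp [F, Subtype.ext_iff]).trans
          (Equiv.subtypeSubtypeEquivSubtypeInter _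
            (fun f : α → ℕ => (Finset.univ : Finset α).filter (fun s => f s ≤ K T) = A))).trans
        ((Equiv.subtypeEquiv (Equiv.piEquivPiSubtypeProd (fun s => s ∈ A) (fun _ => ℕ))
          fun f => isBlockParking_succ_iff hK hα A (by omega) f).trans
        Equiv.subtypeProdEquivProd)
      have hcA : Fintype.card {s // s ∈ A} = M := by rw [Fintype.card_coe, hA]
      have hcB : Fintype.card {s // s ∉ A} = l := by
        have := Fintype.card_subtype_compl (fun s => s ∈ A)
        omega
      have hih := ih (α := {s // s ∈ A}) (by omega) h0
      rw [hcA] at hih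
      rw [Nat.card_congr e, Nat.card_prod, card_parking (K T) l hcB, ← hih]
      ring
    have hprod : 0 < ∏ t ∈ Finset.range T, (K (t + 1) - K t) ^ (K (t + 1) - K t - 2) :=
      Finset.prod_pos fun t _ => pow_pos (Nat.sub_pos_of_lt (hK (Nat.lt_succ_self t))) _
    have hfin : ∀ A, Finite {f // F f = A} := by
      intro A
      apply Nat.finite_of_card_ne_zero
      intro h
      have := hfiber A
      rw [h, zero_mul] at this
      have := M.factorial_pos
      have : 0 < (l + 1) ^ (l - 1) := by positivity
      have : 0 < ((∏ t ∈ Finset.range T, (K (t + 1) - K t) ^ (K (t + 1) - K t - 2)) *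
        M.factorial) * (l + 1) ^ (l - 1) := by positivity
      omega
    rw [← Nat.card_congr (Equiv.sigmaFiberEquiv F), Nat.card_sigma, Finset.prod_range_succ,
      Finset.prod_range_succ, ← mul_assoc, Finset.sum_mul, Finset.sum_congr rfl
      fun A _ => hfiber A, Finset.sum_const, Finset.card_univ, Fintype.card_finset_len, hαl,
      ← Nat.add_choose_mul_factorial_mul_factorial, ← hl,
      show K (T + 1) - K T = l + 1 by omega, show l + 1 - 2 = l - 1 by omega, smul_eq_mul]
    ring

theorem isPF_and_queueLen_iff {m n : ℕ} (hmn : m ≤ n) {K : ℕ → ℕ} (hK : StrictMono K)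
    (h0 : K 0 = 0) (hlast : K (n - m + 1) = n + 1) (π : Fin m → ℕ) :
    (IsPF m n π ∧ ∀ j, 1 ≤ j → j ≤ n → (queueLen m π j = 0 ↔ ∃ t, K t = j)) ↔
      IsBlockParking K (n - m + 1) π := by
  set C : ℕ → ℕ := fun j => ((Finset.univ : Finset (Fin m)).filter (fun s => π s ≤ j)).card
    with hC
  have hCs : ∀ j, C (j + 1) = C j +
      ((Finset.univ : Finset (Fin m)).filter (fun s => π s = j + 1)).card := by
    intro j
    rw [hC, ← Finset.card_union_of_disjoint]
    · refine congrArg Finset.card ?_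
      ext s
      simp only [Finset.mem_union, Finset.mem_filter, Finset.mem_univ, true_and]
      omega
    · rw [Finset.disjoint_filter]
      omega
  have hq : ∀ j, queueLen m π (j + 1) + C j =
      (if queueLen m π j = 0 then 0 else queueLen m π j - 1) + C (j + 1) := by
    intro j
    rw [queueLen, hCs]
    omega
  have hCle : ∀ j, C j ≤ m := fun j => (Finset.card_le_univ _).trans (by simp)
  have hCmono : Monotone C := monotone_nat_of_le_succ fun j => by rw [hCs]; omega
  have hstep : ∀ t, K t < K (t + 1) := fun t => hK (Nat.lt_succ_self t)
  constructor
  · rintro ⟨⟨hr, -⟩, hy⟩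
    have hin : ∀ t < n - m + 1, C (K t) + t = K t → queueLen m π (K t) = 0 →
        ∀ j, K t < j → j < K (t + 1) → queueLen m π j + j = C j + t + 1 := by
      intro t ht h1 h2 j hj
      induction j, hj using Nat.le_induction with
      | base =>
        intro _
        have := hq (K t)
        simp only [h2, if_true] at this
        rw [Nat.succ_eq_add_one]
        omega
      | succ j hj ihj =>
        intro hj'
        have h3 := ihj (by omega)
        have h4 := hK.monotone (show t + 1 ≤ n - m + 1 by omega)
        have h5 : queueLen m π j ≠ 0 := by
          rw [Ne, hy j (by omega) (by omega)]
          rintro ⟨u, rfl⟩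
          have := hK.lt_iff_lt.1 (show K t < K u by omega)
          have := hK.lt_iff_lt.1 (show K u < K (t + 1) by omega)
          omega
        have := hq j
        simp only [h5, if_false] at this
        omega
    have hall : ∀ t < n - m + 1, C (K t) + t = K t ∧ queueLen m π (K t) = 0 := by
      intro t
      induction t with
      | zero =>
        intro _
        rw [h0]
        refine ⟨?_, by rw [queueLen]⟩
        simp only [hC, add_zero, Finset.card_eq_zero, Finset.filter_eq_empty_iff]
        intro s _
        have := (hr s).1
        omega
      | succ t iht =>
        intro ht
        obtain ⟨h1, h2⟩ := iht (by omega)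
        have h3 := hK (show t + 1 < n - m + 1 from ht)
        have h4 : queueLen m π (K (t + 1)) = 0 :=
          (hy _ (by have := hstep t; omega) (by omega)).2 ⟨_, rfl⟩
        refine ⟨?_, h4⟩
        have h5 := hstep t
        obtain ⟨b, hb⟩ : ∃ b, K (t + 1) = b + 1 := ⟨K (t + 1) - 1, by omega⟩
        have h6 := hq b
        rw [← hb, h4] at h6
        rcases Nat.eq_or_lt_of_le (show K t ≤ b by omega) with h7 | h7
        · rw [← h7, h2] at h6
          simp only [if_true] at h6
          omega
        · have h8 := hin t (by omega) h1 h2 b h7 (by omega)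
          have h9 : queueLen m π b ≠ 0 := by
            rw [Ne, hy b (by omega) (by omega)]
            rintro ⟨u, rfl⟩
            have := hK.lt_iff_lt.1 h7
            have := hK.lt_iff_lt.1 (show K u < K (t + 1) by omega)
            omega
          simp only [h9, if_false] at h6
          have := hCmono (show b ≤ K (t + 1) by omega)
          omega
    refine ⟨fun t ht => ?_, fun t ht j hj hj' => ?_⟩
    · rcases Nat.lt_or_eq_of_le ht with ht | rfl
      · exact (hall t ht).1
      · rw [hlast, Finset.filter_true_of_mem fun s _ => (hr s).2.trans (Nat.le_succ n)]
        simp only [Finset.card_univ, Fintype.card_fin]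
        omega
    · obtain ⟨h1, h2⟩ := hall t ht
      change j ≤ C j + t
      rcases Nat.eq_or_lt_of_le hj with rfl | hj
      · exact h1.ge
      · have h3 := hin t ht h1 h2 j hj hj'
        have h4 := hK.monotone (show t + 1 ≤ n - m + 1 by omega)
        have h5 : queueLen m π j ≠ 0 := by
          rw [Ne, hy j (by omega) (by omega)]
          rintro ⟨u, rfl⟩
          have := hK.lt_iff_lt.1 hj
          have := hK.lt_iff_lt.1 hj'
          omega
        omega
  · rintro ⟨h1, h2⟩
    replace h1 : ∀ t ≤ n - m + 1, C (K t) + t = K t := h1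
    replace h2 : ∀ t < n - m + 1, ∀ j, K t ≤ j → j < K (t + 1) → j ≤ C j + t := h2
    have hblock : ∀ j ≤ n, ∃ t < n - m + 1, K t ≤ j ∧ j < K (t + 1) := by
      intro j hj
      have hex : ∃ t, j < K t := ⟨n - m + 1, by omega⟩
      obtain ⟨t, ht⟩ : ∃ t, Nat.find hex = t + 1 := Nat.exists_eq_succ_of_ne_zero fun h => by
        have := Nat.find_spec hex
        rw [h, h0] at this
        omega
      have h3 := Nat.find_spec hex
      have h4 := Nat.find_min hex (show t < Nat.find hex by omega)
      have h5 := Nat.find_min' hex (show j < K (n - m + 1) by omega)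
      rw [ht] at h3
      exact ⟨t, by omega, by omega, h3⟩
    have hin : ∀ t < n - m + 1, queueLen m π (K t) = 0 →
        ∀ j, K t < j → j < K (t + 1) → queueLen m π j + j = C j + t + 1 := by
      intro t ht h3 j hj
      induction j, hj using Nat.le_induction with
      | base =>
        intro _
        have := hq (K t)
        have := h1 t ht.le
        simp only [h3, if_true] at *
        rw [Nat.succ_eq_add_one]
        omega
      | succ j hj ihj =>
        intro hj'
        have h4 := ihj (by omega)
        have h5 := h2 t ht j (by omega) (by omega)
        have h6 : queueLen m π j ≠ 0 := by omega
        have := hq j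
        simp only [h6, if_false] at this
        omega
    have hzero : ∀ t < n - m + 1, queueLen m π (K t) = 0 := by
      intro t
      induction t with
      | zero =>
        intro _
        rw [h0, queueLen]
      | succ t iht =>
        intro ht
        have h3 := iht (by omega)
        have h4 := hstep t
        obtain ⟨b, hb⟩ : ∃ b, K (t + 1) = b + 1 := ⟨K (t + 1) - 1, by omega⟩
        have h5 := hq b
        rw [← hb] at h5
        have h6 := h1 (t + 1) ht.le
        have h7 := h2 t (by omega) b (by omega) (by omega)
        have h8 := hCmono (show b ≤ K (t + 1) by omega)
        rcases Nat.eq_or_lt_of_le (show K t ≤ b by omega) with h9 | h9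
        · rw [← h9, h3] at h5
          simp only [if_true] at h5
          rw [← h9] at h7 h8
          omega
        · have := hin t (by omega) h3 b h9 (by omega)
          split_ifs at h5 <;> omega
    have hcount : ∀ i ≤ n, i ≤ C i + (n - m) := by
      intro i hi
      obtain ⟨t, ht, h3, h4⟩ := hblock i hi
      have := h2 t ht i h3 h4
      omega
    refine ⟨⟨fun s => ⟨?_, ?_⟩, fun i hi hi' => ?_⟩, fun j hj hj' => ?_⟩
    · have h3 := h1 0 (by omega)
      rw [h0, add_zero] at h3
      have h4 : s ∉ (Finset.univ : Finset (Fin m)).filter (fun s => π s ≤ 0) := by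
        rw [Finset.card_eq_zero.1 h3]
        exact Finset.notMem_empty s
      simp only [Finset.mem_filter, Finset.mem_univ, true_and] at h4
      omega
    · have h3 := Finset.eq_univ_of_card
        ((Finset.univ : Finset (Fin m)).filter (fun s => π s ≤ n)) (by
          have h4 : n ≤ C n + (n - m) := hcount n le_rfl
          have h5 := hCle n
          rw [Fintype.card_fin]
          change C n = m
          omega)
      simpa using Finset.ext_iff.1 h3 s
    · have : i ≤ C i + (n - m) := hcount i hi
      change m + i - n ≤ C i
      omega
    · obtain ⟨t, ht, h3, h4⟩ := hblock j hj'
      rcases Nat.eq_or_lt_of_le h3 with rfl | h3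
      · exact iff_of_true (hzero t ht) ⟨t, rfl⟩
      · refine iff_of_false ?_ ?_
        · have := hin t ht (hzero t ht) j h3 h4
          have := h2 t ht j h3.le h4
          omega
        · rintro ⟨u, rfl⟩
          have := hK.lt_iff_lt.1 h3
          have := hK.lt_iff_lt.1 h4
          omega

/-- The number of `π ∈ PF(m,n)` whose unattempted spots are exactly the fixed
spots `k₁ < ⋯ < k_{n-m}` (encoded via a strictly increasing
`k : Fin (n-m+2) → ℕ` with `k 0 = 0` and `k (last) = n + 1`) equals
`[Π_i (k_{i+1} - k_i)^(k_{i+1} - k_i - 2)] · m! / Π_i (k_{i+1} - k_i - 1)!`. -/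
theorem card_PF_fixed_unattempted (m n : ℕ) (hm : 1 ≤ m) (hmn : m ≤ n)
    (k : Fin (n - m + 2) → ℕ) (h0 : k 0 = 0)
    (hlast : k (Fin.last (n - m + 1)) = n + 1) (hmono : StrictMono k) :
    (Nat.card {π : Fin m → ℕ // IsPF m n π ∧
        ∀ j, 1 ≤ j → j ≤ n → (queueLen m π j = 0 ↔ ∃ i, k i = j)} : ℚ) =
      (∏ i : Fin (n - m + 1),
          (((k i.succ - k i.castSucc) ^ (k i.succ - k i.castSucc - 2) : ℕ) : ℚ)) *
        (m.factorial : ℚ) /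
        ∏ i : Fin (n - m + 1), ((k i.succ - k i.castSucc - 1).factorial : ℚ) := by
  set K : ℕ → ℕ := fun t => if h : t < n - m + 2 then k ⟨t, h⟩ else n + 1 + t with hKdef
  have hKk : ∀ i : Fin (n - m + 2), K i = k i := fun i => by simp [hKdef]
  have hK : StrictMono K := by
    refine strictMono_nat_of_lt_succ fun t => ?_
    rcases lt_trichotomy (t + 1) (n - m + 2) with h | h | h
    · have h' : t < n - m + 2 := by omega
      simp only [hKdef, h, h', dif_pos]
      exact hmono (by simp [Fin.lt_def])
    · have h1 : K t = k ⟨t, by omega⟩ := hKk ⟨t, by omega⟩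
      have h2 := hmono.monotone (Fin.le_last ⟨t, by omega⟩)
      have h3 : K (t + 1) = n + 1 + (t + 1) := dif_neg (by omega)
      omega
    · have h1 : K t = n + 1 + t := dif_neg (by omega)
      have h2 : K (t + 1) = n + 1 + (t + 1) := dif_neg (by omega)
      omega
  have hK0 : K 0 = 0 := (hKk 0).trans h0
  have hKlast : K (n - m + 1) = n + 1 := (hKk (Fin.last _)).trans hlast
  have hiff : ∀ π : Fin m → ℕ, (IsPF m n π ∧
      ∀ j, 1 ≤ j → j ≤ n → (queueLen m π j = 0 ↔ ∃ i, k i = j)) ↔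
      IsBlockParking K (n - m + 1) π := by
    intro π
    rw [← isPF_and_queueLen_iff hmn hK hK0 hKlast π]
    refine and_congr_right fun _ => forall₃_congr fun j _ hj => iff_congr Iff.rfl ?_
    constructor
    · rintro ⟨i, rfl⟩
      exact ⟨i, hKk i⟩
    · rintro ⟨t, rfl⟩
      have ht : t < n - m + 1 := hK.lt_iff_lt.1 (by omega)
      exact ⟨⟨t, by omega⟩, (hKk _).symm⟩
  have hcard := card_isBlockParking hK (n - m + 1) (α := Fin m)
    (by rw [Fintype.card_fin]; omega) hK0
  rw [← Nat.card_congr (Equiv.subtypeEquivRight hiff), Fintype.card_fin,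
    Finset.prod_range, Finset.prod_range] at hcard
  have hs : ∀ i : Fin (n - m + 1), K (i + 1) = k i.succ := fun i => hKk i.succ
  have hc : ∀ i : Fin (n - m + 1), K i = k i.castSucc := fun i => hKk i.castSucc
  simp only [hs, hc] at hcard
  rw [eq_div_iff (Finset.prod_ne_zero_iff.2 fun i _ => Nat.cast_ne_zero.2
    (Nat.factorial_ne_zero _))]
  exact_mod_cast hcard
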